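/- arXiv:2512.07775 — 4 statements merged into one kernel-verified Lean document; each statement's English description precedes it below -/
import Mathlib

section
/- (Proposition 3: reduced-set evaluation error bound.) Let e₂, …, e_N be points of the unit sphere 𝕊 of ℝ²⁵⁶ with nonnegative weights w₂, …, w_N and total weight d_tot = Σ_j w_j > 0. Suppose the index set {2, …, N} is partitioned into consecutive blocks η₁, …, η_M, let rᵢ = e_{θ(i)} where θ(i) is the last index of block ηᵢ, let ŵᵢ = Σ_{j∈ηᵢ} w_j, and assume that ‖e_j − rᵢ‖ ≤ 2ε for every i and every j ∈ ηᵢ. Define Γ_E(S) = 1 − (1/d_tot) Σ_{j=2}^{N} w_j · d(e_j, S ∪ {0}) and Γ_R(S) = 1 − (1/d_tot) Σ_{i=1}^{M} ŵᵢ · d(rᵢ, S ∪ {0}), where 0 is the origin of ℝ²⁵⁶. Then for every finite set S ⊆ 𝕊, |Γ_E(S) − Γ_R(S)| ≤ 2ε. -/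
open Metric

/-- Summing over a finite type agrees with summing block by block over a partition. -/
theorem sum_eq_sum_blocks {ι κ A : Type*} [Fintype ι] [Fintype κ] [AddCommMonoid A]
    (η : κ → Finset ι) (hpart : ∀ j, ∃! i, j ∈ η i) (f : ι → A) :
    ∑ j, f j = ∑ i, ∑ j ∈ η i, f j := by
  classical
  choose b hb hb' using hpart
  rw [← Finset.sum_fiberwise Finset.univ b f]
  refine Finset.sum_congr rfl fun i _ => Finset.sum_congr ?_ fun _ _ => rfl
  ext j
  simp only [Finset.mem_filter, Finset.mem_univ, true_and]
  exact ⟨fun h => h ▸ hb j, fun h => (hb' j i h).symm⟩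

/-- Distances to a fixed set differ by at most the distance between the points. -/
theorem abs_infDist_sub_infDist_le {X : Type*} [PseudoMetricSpace X] (T : Set X) (x y : X) :
    |infDist x T - infDist y T| ≤ dist x y := by
  simpa [Real.dist_eq] using (lipschitz_infDist_pt T).dist_le_mul x y

/-- Weighted sums of block-wise close functions are close, relative to the total weight. -/
theorem abs_sum_sub_sum_blocks_le {ι κ : Type*} [Fintype ι] [Fintype κ]
    (η : κ → Finset ι) (hpart : ∀ j, ∃! i, j ∈ η i) (w f : ι → ℝ) (g : κ → ℝ)
    (hw : ∀ j, 0 ≤ w j) {δ : ℝ} (hfg : ∀ i, ∀ j ∈ η i, |f j - g i| ≤ δ) :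
    |∑ j, w j * f j - ∑ i, (∑ j ∈ η i, w j) * g i| ≤ (∑ j, w j) * δ := by
  rw [sum_eq_sum_blocks η hpart fun j => w j * f j, sum_eq_sum_blocks η hpart w,
    ← Finset.sum_sub_distrib, Finset.sum_mul]
  refine (Finset.abs_sum_le_sum_abs _ _).trans (Finset.sum_le_sum fun i _ => ?_)
  rw [Finset.sum_mul, Finset.sum_mul, ← Finset.sum_sub_distrib]
  refine (Finset.abs_sum_le_sum_abs _ _).trans (Finset.sum_le_sum fun j hj => ?_)
  rw [← mul_sub, abs_mul, abs_of_nonneg (hw j)]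
  exact mul_le_mul_of_nonneg_left (hfg i j hj) (hw j)

/-- **Proposition 3: reduced-set evaluation error bound.**
Points `e_j` of the unit sphere of `ℝ²⁵⁶` with nonnegative weights `w_j` of
positive total weight `d_tot` are partitioned into consecutive blocks
`η₁, …, η_M`; the representative of block `i` is `r i = e (θ i)` where `θ i`
is the last index of the block, its weight is `ŵᵢ = Σ_{j ∈ ηᵢ} w_j`, and every
block element satisfies `‖e_j - r i‖ ≤ 2ε`.  With
`Γ_E S = 1 - (1/d_tot) Σ_j w_j · d(e_j, S ∪ {0})` and
`Γ_R S = 1 - (1/d_tot) Σ_i ŵᵢ · d(r i, S ∪ {0})`, every finite `S ⊆ 𝕊`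
satisfies `|Γ_E S - Γ_R S| ≤ 2ε`. -/
theorem reduced_set_evaluation_error_bound
    (N M : ℕ) (e : Fin N → EuclideanSpace ℝ (Fin 256)) (he : ∀ j, ‖e j‖ = 1)
    (w : Fin N → ℝ) (hw : ∀ j, 0 ≤ w j) (hdtot : 0 < ∑ j, w j)
    (η : Fin M → Finset (Fin N))
    (hpart : ∀ j : Fin N, ∃! i : Fin M, j ∈ η i)
    (hconsec : ∀ i i' : Fin M, i < i' → ∀ j ∈ η i, ∀ j' ∈ η i', j < j')
    (θ : Fin M → Fin N)
    (hθmem : ∀ i, θ i ∈ η i) (hθlast : ∀ i, ∀ j ∈ η i, j ≤ θ i)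
    (ε : ℝ) (hε : 0 < ε)
    (hdist : ∀ i, ∀ j ∈ η i, dist (e j) (e (θ i)) ≤ 2 * ε) :
    ∀ S : Finset (EuclideanSpace ℝ (Fin 256)),
      (↑S : Set (EuclideanSpace ℝ (Fin 256))) ⊆ sphere 0 1 →
      |(1 - (1 / ∑ j, w j) *
          ∑ j, w j *
            Metric.infDist (e j)
              ((↑S : Set (EuclideanSpace ℝ (Fin 256))) ∪ {0})) -
        (1 - (1 / ∑ j, w j) *
          ∑ i, (∑ j ∈ η i, w j) *
            Metric.infDist (e (θ i))
              ((↑S : Set (EuclideanSpace ℝ (Fin 256))) ∪ {0}))| ≤ 2 * ε := by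
  intro S _
  have key := abs_sum_sub_sum_blocks_le η hpart w
    (fun j => infDist (e j) ((↑S : Set (EuclideanSpace ℝ (Fin 256))) ∪ {0}))
    (fun i => infDist (e (θ i)) ((↑S : Set (EuclideanSpace ℝ (Fin 256))) ∪ {0})) hw
    fun i j hj => (abs_infDist_sub_infDist_le _ _ _).trans (hdist i j hj)
  rw [sub_sub_sub_cancel_left, ← mul_sub, abs_mul, abs_of_pos (one_div_pos.mpr hdtot),
    abs_sub_comm, one_div, inv_mul_le_iff₀ hdtot]
  exact key
end

section
/- (Nearby solutions from the reduced set lose at most ε.) Let e₁, …, e_N be points of the unit sphere 𝕊 of ℝ²⁵⁶ with nonnegative weights w₁, …, w_N and W = Σᵢ wᵢ > 0, and define Γ(S) = 1 − (1/W) Σ_{i=1}^{N} wᵢ · d(eᵢ, S ∪ {0}) for finite S ⊆ 𝕊, where 0 is the origin. Let ε > 0 and let S_E, S_R be finite subsets of 𝕊 such that for every s ∈ S_E there exists s′ ∈ S_R with ‖s − s′‖ ≤ ε. Then Γ(S_R) ≥ Γ(S_E) − ε. -/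
open Metric

/-- If every point of a nonempty set `s` is within `ε` of a point of `t`, then the distance to `t`
exceeds the distance to `s` by at most `ε`. -/
theorem infDist_le_infDist_add_of_forall_exists_dist_le {α : Type*} [PseudoMetricSpace α]
    {s t : Set α} {ε : ℝ} (hs : s.Nonempty) (h : ∀ y ∈ s, ∃ z ∈ t, dist y z ≤ ε) (x : α) :
    infDist x t ≤ infDist x s + ε := by
  rw [← sub_le_iff_le_add, le_infDist hs]
  intro y hy
  obtain ⟨z, hz, hyz⟩ := h y hy
  linarith [infDist_le_dist_of_mem (x := x) hz, dist_triangle x y z]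

/-- **Nearby solutions from the reduced set lose at most ε.**
Let `e₁, …, e_N` be points of the unit sphere `𝕊` of `ℝ²⁵⁶` with nonnegative
weights `w₁, …, w_N`, `W = Σᵢ wᵢ > 0`, and define
`Γ S = 1 - (1/W) Σᵢ wᵢ · d(eᵢ, S ∪ {0})` for finite `S ⊆ 𝕊`.  If `ε > 0` and
`S_E, S_R` are finite subsets of `𝕊` such that every `s ∈ S_E` has some
`s' ∈ S_R` with `‖s - s'‖ ≤ ε`, then `Γ S_R ≥ Γ S_E - ε`. -/
theorem reduced_set_solution_loss
    (N : ℕ) (e : Fin N → EuclideanSpace ℝ (Fin 256)) (he : ∀ i, ‖e i‖ = 1)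
    (w : Fin N → ℝ) (hw : ∀ i, 0 ≤ w i) (hW : 0 < ∑ i, w i)
    (Γ : Finset (EuclideanSpace ℝ (Fin 256)) → ℝ)
    (hΓ : ∀ S : Finset (EuclideanSpace ℝ (Fin 256)),
      (↑S : Set (EuclideanSpace ℝ (Fin 256))) ⊆ sphere 0 1 →
      Γ S = 1 - (1 / ∑ i, w i) *
        ∑ i, w i *
          Metric.infDist (e i)
            ((↑S : Set (EuclideanSpace ℝ (Fin 256))) ∪ {0}))
    (ε : ℝ) (hε : 0 < ε)
    (S_E S_R : Finset (EuclideanSpace ℝ (Fin 256)))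
    (hSE : (↑S_E : Set (EuclideanSpace ℝ (Fin 256))) ⊆ sphere 0 1)
    (hSR : (↑S_R : Set (EuclideanSpace ℝ (Fin 256))) ⊆ sphere 0 1)
    (hclose : ∀ s ∈ S_E, ∃ s' ∈ S_R, ‖s - s'‖ ≤ ε) :
    Γ S_E - ε ≤ Γ S_R := by
  have key (i : Fin N) := infDist_le_infDist_add_of_forall_exists_dist_le
    (s := (↑S_E : Set (EuclideanSpace ℝ (Fin 256))) ∪ {0})
    (t := (↑S_R : Set (EuclideanSpace ℝ (Fin 256))) ∪ {0}) (ε := ε) ⟨0, Or.inr rfl⟩ (by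
      rintro y (hy | rfl)
      · obtain ⟨z, hz, hyz⟩ := hclose y hy
        exact ⟨z, Or.inl hz, by rwa [dist_eq_norm]⟩
      · exact ⟨0, Or.inr rfl, by simpa using hε.le⟩) (e i)
  have hsum := Finset.sum_le_sum fun i (_ : i ∈ Finset.univ) =>
    mul_le_mul_of_nonneg_left (key i) (hw i)
  simp only [mul_add, Finset.sum_add_distrib, ← Finset.sum_mul] at hsum
  have hdiv := mul_le_mul_of_nonneg_left hsum (one_div_pos.2 hW).le
  rw [mul_add, ← mul_assoc _ _ ε, one_div_mul_cancel hW.ne', one_mul] at hdiv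
  rw [hΓ S_E hSE, hΓ S_R hSR]
  linarith
end

section
/- (Threshold-admission induction behind Sieve-Streaming.) Let f be a real-valued set function on finite subsets of a set X with f(∅) ≥ 0, let k ≥ 1 be an integer, and let v ≥ 0. Let x₁, …, x_m be distinct elements of X with m ≤ k, and set S₀ = ∅ and Sᵢ = {x₁, …, xᵢ}. Suppose that each added element meets the Sieve-Streaming threshold: f(S_{i+1}) − f(Sᵢ) ≥ (v/2 − f(Sᵢ)) / (k − i) for all 0 ≤ i < m. Then f(Sᵢ) ≥ (i/k) · (v/2) for every 0 ≤ i ≤ m; in particular, if m = k then f(S_k) ≥ v/2. -/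
/-- If a sequence with nonnegative start closes, at step `i`, at least a `1 / (k - i)` fraction of
its gap to `w`, then after `i` steps it has reached at least the fraction `i / k` of `w`. -/
theorem natCast_mul_le_mul_of_div_sub_le_sub {a : ℕ → ℝ} (ha : 0 ≤ a 0) {k m : ℕ} (hm : m ≤ k)
    {w : ℝ} (h : ∀ i < m, (w - a i) / ((k : ℝ) - i) ≤ a (i + 1) - a i) :
    ∀ i ≤ m, (i : ℝ) * w ≤ k * a i := by
  intro i
  induction i with
  | zero => intro _; simpa using mul_nonneg k.cast_nonneg ha
  | succ i ih =>
    intro hi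
    have hik : (i : ℝ) + 1 ≤ k := by exact_mod_cast hi.trans hm
    have hd : 0 < (k : ℝ) - i := by linarith
    have hstep := (div_le_iff₀ hd).1 (h i hi)
    have hprev := mul_le_mul_of_nonneg_left (ih (Nat.le_of_succ_le hi)) (sub_nonneg.2 hik)
    have hstep' := mul_le_mul_of_nonneg_left hstep k.cast_nonneg
    push_cast
    refine le_of_mul_le_mul_left ?_ hd
    linarith

/-- **Threshold-admission induction behind Sieve-Streaming.**
Let `f` be a real-valued set function on finite subsets of `X` with `f ∅ ≥ 0`,
let `k ≥ 1`, `v ≥ 0`, and let `x₁, …, x_m` be distinct elements of `X` with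
`m ≤ k`.  Setting `S₀ = ∅` and `Sᵢ₊₁ = Sᵢ ∪ {xᵢ₊₁}`, suppose each added element
meets the Sieve-Streaming threshold
`f(Sᵢ₊₁) - f(Sᵢ) ≥ (v/2 - f(Sᵢ)) / (k - i)` for all `0 ≤ i < m`.
Then `f(Sᵢ) ≥ (i/k) · (v/2)` for every `0 ≤ i ≤ m`; in particular if `m = k`
then `f(S_k) ≥ v/2`. -/
theorem sieveStreaming_threshold_induction
    {X : Type*} [DecidableEq X] (f : Finset X → ℝ) (hf0 : 0 ≤ f ∅)
    (k : ℕ) (hk : 1 ≤ k) (v : ℝ) (hv : 0 ≤ v)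
    (m : ℕ) (hm : m ≤ k) (x : Fin m → X) (hx : Function.Injective x)
    (S : ℕ → Finset X) (hS0 : S 0 = ∅)
    (hSsucc : ∀ i : Fin m, S ((i : ℕ) + 1) = insert (x i) (S (i : ℕ)))
    (hthresh : ∀ i : ℕ, i < m →
      (v / 2 - f (S i)) / ((k : ℝ) - (i : ℝ)) ≤ f (S (i + 1)) - f (S i)) :
    (∀ i : ℕ, i ≤ m → ((i : ℝ) / (k : ℝ)) * (v / 2) ≤ f (S i)) ∧
      (m = k → v / 2 ≤ f (S k)) := by
  have hk0 : (0 : ℝ) < k := by exact_mod_cast hk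
  have key := natCast_mul_le_mul_of_div_sub_le_sub (a := fun i => f (S i))
    (by simpa [hS0] using hf0) hm hthresh
  refine ⟨fun i hi => ?_, ?_⟩
  · rw [div_mul_eq_mul_div, div_le_iff₀' hk0]
    exact key i hi
  · rintro rfl
    exact le_of_mul_le_mul_left (key m le_rfl) hk0
end

section
/- (Rejection bound behind Sieve-Streaming.) Let E be a finite set, let f be a monotone non-decreasing, submodular set function on subsets of E, let k ≥ 1 be an integer and v ≥ 0 a real number. Let S ⊆ E be a set such that every element outside S has small marginal value: f(S ∪ {e}) − f(S) ≤ v/(2k) for all e ∈ E \ S. Then for every T ⊆ E with |T| ≤ k, f(T) ≤ f(S) + v/2. In particular, if v ≤ OPT, where OPT = max{ f(T) : T ⊆ E, |T| ≤ k }, then f(S) ≥ v/2. -/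
/-- If every element outside `S` has marginal value at most `c ≥ 0` over `S`, then adjoining `T` to
`S` increases a submodular function by at most `T.card * c`. -/
theorem submodular_union_le_add_card_mul {ι : Type*} [DecidableEq ι] {f : Finset ι → ℝ}
    (hsub : ∀ A B : Finset ι, A ⊆ B → ∀ x ∉ B,
      f (insert x B) - f B ≤ f (insert x A) - f A)
    {S : Finset ι} {c : ℝ} (hc : 0 ≤ c) (hrej : ∀ e ∉ S, f (insert e S) - f S ≤ c)
    (T : Finset ι) : f (S ∪ T) ≤ f S + T.card * c := by
  induction T using Finset.induction_on with
  | empty => simp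
  | insert a T ha ih =>
    rw [Finset.union_insert, Finset.card_insert_of_notMem ha]
    push_cast
    by_cases h : a ∈ S ∪ T
    · rw [Finset.insert_eq_of_mem h]
      linarith
    · have h₁ := hsub S (S ∪ T) Finset.subset_union_left a h
      have h₂ := hrej a fun haS => h (Finset.mem_union_left T haS)
      linarith

/-- **Rejection bound behind Sieve-Streaming.**
Let `E` be a finite set (here: a finite type `ι`), `f` a monotone
non-decreasing submodular set function on subsets of `E`, `k ≥ 1` an integer
and `v ≥ 0` a real.  If `S` is a set such that every element outside `S` has
marginal value at most `v / (2k)`, then every `T` with `|T| ≤ k` satisfies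
`f T ≤ f S + v/2`; in particular, if `v ≤ OPT := max {f T : |T| ≤ k}`, then
`f S ≥ v/2`. -/
theorem sieveStreaming_rejection_bound
    {ι : Type*} [Fintype ι] [DecidableEq ι] (f : Finset ι → ℝ)
    (hmono : ∀ A B : Finset ι, A ⊆ B → f A ≤ f B)
    (hsub : ∀ A B : Finset ι, A ⊆ B → ∀ x ∉ B,
      f (insert x B) - f B ≤ f (insert x A) - f A)
    (k : ℕ) (hk : 1 ≤ k) (v : ℝ) (hv : 0 ≤ v)
    (S : Finset ι)
    (hrej : ∀ e ∉ S, f (insert e S) - f S ≤ v / (2 * k)) :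
    (∀ T : Finset ι, T.card ≤ k → f T ≤ f S + v / 2) ∧
      (v ≤ (Finset.filter (fun T => T.card ≤ k)
              (Finset.univ : Finset ι).powerset).sup'
            ⟨∅, by simp⟩ f → v / 2 ≤ f S) := by
  have bound : ∀ T : Finset ι, T.card ≤ k → f T ≤ f S + v / 2 := by
    intro T hT
    have hk₀ : (0 : ℝ) < k := by exact_mod_cast hk
    have hc : 0 ≤ v / (2 * k) := by positivity
    calc f T ≤ f (S ∪ T) := hmono _ _ Finset.subset_union_right
      _ ≤ f S + T.card * (v / (2 * k)) := submodular_union_le_add_card_mul hsub hc hrej T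
      _ ≤ f S + k * (v / (2 * k)) := by gcongr
      _ = f S + v / 2 := by field_simp
  refine ⟨bound, fun hopt => ?_⟩
  obtain ⟨T, hT, hvT⟩ := (Finset.le_sup'_iff _).1 hopt
  have hfT := bound T (Finset.mem_filter.1 hT).2
  linarith
end
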